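/- Let N ≥ 1 and d ≥ 1 be integers. For every invertible (N+1)×(N+1) complex matrix A and every Wronskian datum 𝒫 of degree d, the polynomial A·W_𝒫 lies in the ℂ-linear span of the family (W_𝒫')_{𝒫'} indexed by all Wronskian data of degree d; in other words, the span of the W_𝒫 is stable under the action of GL_{N+1}(ℂ). -/

import Mathlib

open MvPolynomial

/-- A Wronskian datum of degree `d` in variables indexed by `Fin (N+1)`.  It is encoded by the
nondecreasing list `n_1 ≤ … ≤ n_d` of indices (`i` repeated `m_i` times) together with the
concatenated tuple `(α_1, …, α_d)` of exponents; within each block `{s | n s = i}` the exponents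
are strictly increasing and bounded by `m_0 + m_1 + … + m_i = #{t | n t ≤ i}`. -/
structure WronskDatum (N d : ℕ) where
  n : Fin d → Fin (N + 1)
  a : Fin d → ℕ
  mono : Monotone n
  strictOnBlocks : ∀ s t : Fin d, s < t → n s = n t → a s < a t
  bound : ∀ s : Fin d, a s < (Finset.univ.filter fun t => n t ≤ n s).card

/-- The polynomial `W_𝒫`: the determinant of the `d × d` matrix whose entry in row `r` and
column `s` is `(r choose α_s) · (α_s)! · X_{n_s}^{(r − α_s)}` if `r ≥ α_s` and `0` otherwise. -/
noncomputable def Wpoly {N d : ℕ} (D : WronskDatum N d) : MvPolynomial (Fin (N + 1) × ℕ) ℂ :=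
  Matrix.det (Matrix.of fun r s : Fin d =>
    if D.a s ≤ (r : ℕ) then
      (((r : ℕ).choose (D.a s) * (D.a s).factorial : ℕ) : ℂ) • X (D.n s, (r : ℕ) - D.a s)
    else 0)

/-- The action of a matrix `A` on `V`, substituting `X_i^{(k)} ↦ ∑_{j} A_{ij} · X_j^{(k)}`. -/
noncomputable def matAct (N : ℕ) (A : Matrix (Fin (N + 1)) (Fin (N + 1)) ℂ) :
    MvPolynomial (Fin (N + 1) × ℕ) ℂ →ₐ[ℂ] MvPolynomial (Fin (N + 1) × ℕ) ℂ :=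
  aeval fun p => ∑ j, C (A p.1 j) * X (j, p.2)

/-- The `r`-th derivative at `t = 0` of `t ^ a * X_i(t)`. -/
noncomputable def wronskEntry {N : ℕ} (i : Fin (N + 1)) (a r : ℕ) :
    MvPolynomial (Fin (N + 1) × ℕ) ℂ :=
  if a ≤ r then ((r.choose a * a.factorial : ℕ) : ℂ) • X (i, r - a) else 0

/-- The Wronskian at `t = 0` of the functions `t ^ a s * X_{n s}(t)`, for arbitrary `n` and `a`. -/
noncomputable def wronskDet {N d : ℕ} (n : Fin d → Fin (N + 1)) (a : Fin d → ℕ) :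
    MvPolynomial (Fin (N + 1) × ℕ) ℂ :=
  Matrix.det (Matrix.of fun r s : Fin d => wronskEntry (n s) (a s) r)

theorem Wpoly_eq_wronskDet {N d : ℕ} (D : WronskDatum N d) : Wpoly D = wronskDet D.n D.a := rfl

/-- Multiplication by `t` on `r`-th derivatives at `t = 0`. -/
theorem wronskEntry_succ_succ {N : ℕ} (i : Fin (N + 1)) (a r : ℕ) :
    wronskEntry i (a + 1) (r + 1) = ((r + 1 : ℕ) : MvPolynomial (Fin (N + 1) × ℕ) ℂ) *
      wronskEntry i a r := by
  unfold wronskEntry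
  by_cases h : a ≤ r
  · rw [if_pos h, if_pos (Nat.succ_le_succ h), Nat.succ_sub_succ, smul_eq_C_mul, smul_eq_C_mul,
      ← mul_assoc]
    congr 1
    rw [← map_natCast (C : ℂ →+* MvPolynomial (Fin (N + 1) × ℕ) ℂ), ← C_mul, ← Nat.cast_mul,
      Nat.factorial_succ, ← mul_assoc, ← mul_assoc, Nat.add_one_mul_choose_eq]
  · rw [if_neg h, if_neg (by omega), mul_zero]

theorem wronskEntry_succ_zero {N : ℕ} (i : Fin (N + 1)) (a : ℕ) :
    wronskEntry i (a + 1) 0 = 0 := by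
  simp [wronskEntry]

theorem wronskEntry_of_lt {N : ℕ} (i : Fin (N + 1)) {a r : ℕ} (h : r < a) :
    wronskEntry i a r = 0 := by
  simp [wronskEntry, h]

/-- Multilinear expansion of a determinant whose columns are linear combinations. -/
theorem det_sum_smul_columns {R ι κ : Type*} [CommRing R] [Fintype ι] [DecidableEq ι]
    [DecidableEq κ] (T : ι → Finset κ) (c : ι → κ → R) (B : ι → κ → ι → R) :
    Matrix.det (Matrix.of fun r s => ∑ j ∈ T s, c s j * B s j r) =
      ∑ p ∈ Fintype.piFinset T,
        (∏ s, c s (p s)) * Matrix.det (Matrix.of fun r s => B s (p s) r) := by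
  have h := (Matrix.detRowAlternating (R := R) (n := ι)).toMultilinearMap.map_sum_finset
    (fun s j => c s j • B s j) T
  rw [← Matrix.det_transpose]
  refine Eq.trans ?_ (h.trans (Finset.sum_congr rfl fun p _ => ?_))
  · refine congrArg Matrix.det ?_
    ext s r
    simp [Finset.sum_apply]
  · rw [MultilinearMap.map_smul_univ, ← Matrix.det_transpose (Matrix.of _)]
    rfl

/-- The matrix of multiplication by `1 - z t` on derivatives at `t = 0`. -/
noncomputable def oneSubShift (R : Type*) [CommRing R] (d : ℕ) :
    Matrix (Fin d) (Fin d) (Polynomial R) :=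
  Matrix.of fun r q => (if r = q then 1 else 0) -
    if (r : ℕ) = q + 1 then ((r : ℕ) : Polynomial R) * Polynomial.X else 0

theorem det_oneSubShift (R : Type*) [CommRing R] (d : ℕ) : (oneSubShift R d).det = 1 := by
  rw [Matrix.det_of_isLowerTriangular]
  · refine Finset.prod_eq_one fun r _ => ?_
    simp [oneSubShift]
  · intro r q h
    have h' : (r : ℕ) < q := h
    have : r ≠ q := fun e => by simp [e] at h'
    simp [oneSubShift, this, show (r : ℕ) ≠ q + 1 by omega]

theorem oneSubShift_mulVec {R : Type*} [CommRing R] {d : ℕ} (f : ℕ → Polynomial R)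
    (r : Fin d) : ∑ q, oneSubShift R d r q * f q =
      f r - if (r : ℕ) = 0 then 0 else ((r : ℕ) : Polynomial R) * Polynomial.X * f (r - 1) := by
  simp only [oneSubShift, Matrix.of_apply, sub_mul, Finset.sum_sub_distrib, ite_mul, one_mul,
    zero_mul, Finset.sum_ite_eq, Finset.mem_univ, if_true]
  congr 1
  by_cases h : (r : ℕ) = 0
  · simp [h]
  · rw [if_neg h, Finset.sum_eq_single (⟨r - 1, by omega⟩ : Fin d)]
    · rw [if_pos (by simp; omega)]
    · intro q _ hq
      rw [if_neg]
      intro e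
      exact hq (Fin.ext (by simp [e]))
    · simp

theorem det_map_C_wronskEntry {N d : ℕ} (n : Fin d → Fin (N + 1)) (a : Fin d → ℕ) :
    Matrix.det (Matrix.of fun r s : Fin d => Polynomial.C (wronskEntry (n s) (a s) r)) =
      Polynomial.C (wronskDet n a) := by
  rw [wronskDet, RingHom.map_det]
  rfl

/-- The complete homogeneous symmetric polynomial of degree `k` in the variables indexed by `S`
annihilates the Wronskian as soon as `d < k + #S`. -/
theorem sum_wronskDet_eq_zero {N d : ℕ} (n : Fin d → Fin (N + 1)) (a : Fin d → ℕ)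
    (S : Finset (Fin d)) (k : ℕ) (hk : d < k + S.card) :
    ∑ b ∈ (Fintype.piFinset fun s => if s ∈ S then Finset.range (d + 1) else {0}) with
      ∑ s, b s = k, wronskDet n (a + b) = 0 := by
  let B : Fin d → ℕ → Fin d → Polynomial (MvPolynomial (Fin (N + 1) × ℕ) ℂ) :=
    fun s j r => Polynomial.C (wronskEntry (n s) (a s + j) r)
  let T : Fin d → Finset ℕ := fun s => if s ∈ S then Finset.range (d + 1) else {0}
  let T' : Fin d → Finset ℕ := fun s => if s ∈ S then {0} else Finset.range 2
  have hmul : oneSubShift (MvPolynomial (Fin (N + 1) × ℕ) ℂ) d *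
      (Matrix.of fun r s => ∑ j ∈ T s, Polynomial.X ^ j * B s j r) =
      Matrix.of fun r s => ∑ j ∈ T' s, (-Polynomial.X) ^ j * B s j r := by
    have hstep : ∀ (s r : Fin d) (j : ℕ),
        (if (r : ℕ) = 0 then 0 else ((r : ℕ) : Polynomial (MvPolynomial (Fin (N + 1) × ℕ) ℂ)) * Polynomial.X *
          Polynomial.C (wronskEntry (n s) (a s + j) (r - 1))) =
        Polynomial.X * Polynomial.C (wronskEntry (n s) (a s + (j + 1)) r) := by
      intro s r j
      obtain ⟨r, hr⟩ := r
      cases r with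
      | zero => simp [← add_assoc, wronskEntry_succ_zero]
      | succ r =>
        simp only [Nat.add_one_ne_zero, if_false, ← add_assoc, wronskEntry_succ_succ, map_mul,
          Nat.add_sub_cancel, map_natCast]
        ring
    ext1 r s
    rw [Matrix.mul_apply]
    simp only [Matrix.of_apply, Finset.mul_sum]
    rw [Finset.sum_comm]
    have hj : ∀ j, ∑ q : Fin d, oneSubShift (MvPolynomial (Fin (N + 1) × ℕ) ℂ) d r q *
        (Polynomial.X ^ j * B s j q) =
        Polynomial.X ^ j * B s j r - Polynomial.X ^ (j + 1) * B s (j + 1) r := by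
      intro j
      have := oneSubShift_mulVec
        (fun q => Polynomial.X ^ j * Polynomial.C (wronskEntry (n s) (a s + j) q)) r
      refine this.trans ?_
      congr 1
      rw [pow_succ, mul_assoc (Polynomial.X ^ j)]
      refine Eq.trans ?_ (congrArg (Polynomial.X ^ j * ·) (hstep s r j))
      simp only [mul_ite, mul_zero]
      refine if_congr Iff.rfl rfl ?_
      ring
    simp only [hj]
    by_cases hs : s ∈ S
    · simp only [T, T', if_pos hs]
      rw [Finset.sum_range_sub']
      simp [B, wronskEntry_of_lt (n s) (show (r : ℕ) < a s + (d + 1) by omega)]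
    · simp only [T, T', if_neg hs]
      simp only [Finset.sum_range_succ, Finset.sum_singleton, Finset.sum_range_zero]
      ring
  have hdet := congrArg Matrix.det hmul
  rw [Matrix.det_mul, det_oneSubShift, one_mul, det_sum_smul_columns, det_sum_smul_columns] at hdet
  have hcoeff := congrArg (fun p => Polynomial.coeff p k) hdet
  simp only [Polynomial.finsetSum_coeff, Finset.prod_pow_eq_pow_sum] at hcoeff
  rw [Finset.sum_filter]
  refine Eq.trans (Finset.sum_congr rfl fun b _ => ?_) (hcoeff.trans (Finset.sum_eq_zero ?_))
  · have := det_map_C_wronskEntry n (a + b)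
    simp only [Pi.add_apply] at this
    simp only [B, this, Polynomial.coeff_mul_C, Polynomial.coeff_X_pow, eq_comm (a := k)]
    simp
  · intro b hb
    have := det_map_C_wronskEntry n (a + b)
    simp only [Pi.add_apply] at this
    simp only [B, this, Polynomial.coeff_mul_C]
    have hlt : ∑ s, b s < k := by
      have hle : ∑ s, b s ≤ ∑ s : Fin d, if s ∈ S then 0 else 1 := by
        refine Finset.sum_le_sum fun s _ => ?_
        have := Fintype.mem_piFinset.1 hb s
        simp only [T'] at this
        split_ifs at this ⊢ <;> simp at this <;> omega
      have hcard : (∑ s : Fin d, if s ∈ S then 0 else 1) + S.card = d := by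
        have : S.card = ∑ s : Fin d, if s ∈ S then 1 else 0 := by simp
        rw [this, ← Finset.sum_add_distrib]
        rw [Finset.sum_congr rfl (g := fun _ => 1) (fun s _ => by split_ifs <;> rfl)]
        simp
      omega
    rw [neg_pow, show ((-1 : Polynomial (MvPolynomial (Fin (N + 1) × ℕ) ℂ)) ^ (∑ s, b s)) =
        Polynomial.C ((-1) ^ (∑ s, b s)) by simp,
      Polynomial.coeff_C_mul, Polynomial.coeff_X_pow, if_neg (by omega), mul_zero, zero_mul]

theorem wronskDet_comp_perm {N d : ℕ} (n : Fin d → Fin (N + 1)) (a : Fin d → ℕ)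
    (σ : Equiv.Perm (Fin d)) :
    wronskDet (n ∘ σ) (a ∘ σ) = (Equiv.Perm.sign σ : ℤ) • wronskDet n a := by
  have := Matrix.det_permute' σ (Matrix.of fun r s : Fin d => wronskEntry (n s) (a s) r)
  rw [zsmul_eq_mul]
  exact this

theorem wronskDet_eq_zero_of_not_injective {N d : ℕ} (n : Fin d → Fin (N + 1)) (a : Fin d → ℕ)
    (h : ¬ Function.Injective fun s => toLex (n s, a s)) : wronskDet n a = 0 := by
  simp only [Function.Injective, not_forall] at h
  obtain ⟨s, t, hst, hne⟩ := h
  have hst' : (n s, a s) = (n t, a t) := toLex.injective hst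
  rw [Prod.mk.injEq] at hst'
  refine Matrix.det_zero_of_column_eq hne fun r => ?_
  simp [hst'.1, hst'.2]

/-- A Wronskian whose exponents satisfy the bounds is, up to sign, zero or some `W_𝒫`. -/
theorem wronskDet_mem_span_of_bound {N d : ℕ} (n : Fin d → Fin (N + 1)) (a : Fin d → ℕ)
    (hb : ∀ s, a s < (Finset.univ.filter fun t => n t ≤ n s).card) :
    wronskDet n a ∈ Submodule.span ℂ (Set.range (Wpoly (N := N) (d := d))) := by
  by_cases hinj : Function.Injective fun s => toLex (n s, a s)
  · let σ := Tuple.sort fun s => toLex (n s, a s)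
    have hmono : StrictMono ((fun s => toLex (n s, a s)) ∘ σ) :=
      (Tuple.monotone_sort _).strictMono_of_injective (hinj.comp σ.injective)
    have hlex : ∀ s t, s < t → n (σ s) < n (σ t) ∨ n (σ s) = n (σ t) ∧ a (σ s) < a (σ t) := by
      intro s t h
      exact (Prod.Lex.toLex_lt_toLex).1 (hmono h)
    let D : WronskDatum N d :=
      { n := n ∘ σ
        a := a ∘ σ
        mono := by
          intro s t hst
          rcases hst.eq_or_lt with rfl | h
          · exact le_rfl
          · rcases hlex s t h with h | h
            · exact h.le
            · exact h.1.le
        strictOnBlocks := by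
          intro s t hst he
          rcases hlex s t hst with h | h
          · exact absurd he h.ne
          · exact h.2
        bound := by
          intro s
          refine (hb (σ s)).trans_eq ?_
          refine (Finset.card_bij (fun t _ => σ t) ?_ ?_ ?_).symm
          · intro t ht
            simpa using ht
          · intro t _ t' _ h
            exact σ.injective h
          · intro t ht
            exact ⟨σ.symm t, by simpa using ht, by simp⟩ }
    have hD : Wpoly D = (Equiv.Perm.sign σ : ℤ) • wronskDet n a := wronskDet_comp_perm n a σ
    have hW : wronskDet n a = (Equiv.Perm.sign σ : ℤ) • Wpoly D := by
      rw [hD, smul_smul, ← Units.val_mul, Int.units_mul_self, Units.val_one, one_smul]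
    rw [hW]
    exact zsmul_mem (Submodule.subset_span (Set.mem_range_self D)) _
  · rw [wronskDet_eq_zero_of_not_injective n a hinj]
    exact zero_mem _

/-- Straightening: every Wronskian lies in the span of the `W_𝒫`. -/
theorem wronskDet_mem_span {N d : ℕ} (n : Fin d → Fin (N + 1)) (a : Fin d → ℕ) :
    wronskDet n a ∈ Submodule.span ℂ (Set.range (Wpoly (N := N) (d := d))) := by
  induction hμ : ∑ s, a s * (N + 1 - n s) using Nat.strong_induction_on generalizing a with
  | _ μ ih =>
  subst hμ
  by_cases hb : ∀ s, a s < (Finset.univ.filter fun t => n t ≤ n s).card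
  · exact wronskDet_mem_span_of_bound n a hb
  push Not at hb
  obtain ⟨s, hs⟩ := hb
  set M := (Finset.univ.filter fun t => n t ≤ n s).card with hM
  let S : Finset (Fin d) := insert s (Finset.univ.filter fun t => n s < n t)
  let a₀ : Fin d → ℕ := Function.update a s (a s - M)
  let e : Fin d → ℕ := Pi.single s M
  have hcompl : M + (Finset.univ.filter fun t => n s < n t).card = d := by
    have := Finset.card_filter_add_card_filter_not (s := (Finset.univ : Finset (Fin d)))
      (fun t => n t ≤ n s)
    simpa using this
  have hS : d < M + S.card := by
    rw [Finset.card_insert_of_notMem (by simp)]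
    omega
  have ha : a₀ + e = a := by
    ext t
    by_cases h : t = s
    · subst h
      simp [a₀, e, Nat.sub_add_cancel hs]
    · simp [a₀, e, h]
  have hzero := sum_wronskDet_eq_zero n a₀ S M hS
  have he : e ∈ (Fintype.piFinset fun s => if s ∈ S then Finset.range (d + 1) else {0}).filter
      fun b => ∑ s, b s = M := by
    rw [Finset.mem_filter, Fintype.mem_piFinset]
    refine ⟨fun t => ?_, by simp [e]⟩
    by_cases h : t = s
    · subst h
      simp only [S, Finset.mem_insert_self, if_true, e, Pi.single_eq_same, Finset.mem_range]
      omega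
    · simp only [e, Pi.single_eq_of_ne h]
      split_ifs <;> simp
  rw [← Finset.add_sum_erase _ _ he, ha] at hzero
  rw [eq_neg_of_add_eq_zero_left hzero]
  refine neg_mem (Submodule.sum_mem _ fun b hb => ih _ ?_ (a₀ + b) rfl)
  rw [Finset.mem_erase, Finset.mem_filter, Fintype.mem_piFinset] at hb
  obtain ⟨hbe, hbS, hbM⟩ := hb
  have hw : ∀ t, b t ≠ 0 → t ≠ s → n s < n t := by
    intro t ht hts
    have := hbS t
    by_contra hlt
    have htS : t ∉ S := by simp [S, hts, not_lt.1 hlt]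
    rw [if_neg htS, Finset.mem_singleton] at this
    exact ht this
  obtain ⟨t, hts, hbt⟩ : ∃ t, t ≠ s ∧ b t ≠ 0 := by
    by_contra! hcon
    apply hbe
    ext t
    by_cases h : t = s
    · subst h
      simp only [e, Pi.single_eq_same]
      rw [← hbM, Finset.sum_eq_single t (fun u _ hu => hcon u hu) (by simp)]
    · simp [e, h, hcon t h]
  have hlt : ∑ t, b t * (N + 1 - n t) < ∑ t, e t * (N + 1 - n t) := by
    have hE : ∑ t, e t * (N + 1 - n t) = ∑ t, b t * (N + 1 - n s) := by
      rw [← Finset.sum_mul, hbM, Finset.sum_eq_single s (fun u _ hu => by simp [e, hu]) (by simp)]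
      simp [e]
    rw [hE]
    refine Finset.sum_lt_sum (fun u _ => ?_) ⟨t, Finset.mem_univ t, ?_⟩
    · by_cases hu : b u = 0
      · simp [hu]
      · by_cases hus : u = s
        · rw [hus]
        · have : (n s : ℕ) < n u := hw u hu hus
          exact Nat.mul_le_mul_left _ (by omega)
    · have h1 : (n s : ℕ) < n t := hw t hbt hts
      have h2 := (n t).isLt
      exact Nat.mul_lt_mul_of_pos_left (by omega) (Nat.pos_of_ne_zero hbt)
  conv_rhs => rw [← ha]
  simp only [Pi.add_apply, add_mul, Finset.sum_add_distrib]
  omega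

theorem matAct_wronskEntry {N : ℕ} (A : Matrix (Fin (N + 1)) (Fin (N + 1)) ℂ)
    (i : Fin (N + 1)) (a r : ℕ) :
    matAct N A (wronskEntry i a r) = ∑ j, C (A i j) * wronskEntry j a r := by
  unfold wronskEntry
  split_ifs
  · rw [map_smul, matAct, aeval_X, Finset.smul_sum]
    exact Finset.sum_congr rfl fun j _ => (mul_smul_comm _ _ _).symm
  · simp

/-- For every invertible matrix `A` and every Wronskian datum `𝒫` of degree `d`, the polynomial
`A·W_𝒫` lies in the ℂ-linear span of the family `(W_𝒫')_{𝒫'}`: the span of the `W_𝒫` is stable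
under the action of `GL_{N+1}(ℂ)`. -/
theorem matAct_wronskian_mem_span (N d : ℕ) (hN : 1 ≤ N) (hd : 1 ≤ d)
    (A : Matrix (Fin (N + 1)) (Fin (N + 1)) ℂ) (hA : IsUnit A) (D : WronskDatum N d) :
    matAct N A (Wpoly D) ∈ Submodule.span ℂ (Set.range (Wpoly (N := N) (d := d))) := by
  have hexp : matAct N A (Wpoly D) =
      Matrix.det (Matrix.of fun r s : Fin d =>
        ∑ j ∈ Finset.univ, C (A (D.n s) j) * wronskEntry j (D.a s) r) := by
    rw [Wpoly_eq_wronskDet, wronskDet, AlgHom.map_det]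
    refine congrArg Matrix.det ?_
    ext1 r s
    exact matAct_wronskEntry A _ _ _
  rw [hexp, det_sum_smul_columns (fun _ => Finset.univ) (fun s j => C (A (D.n s) j))
    (fun s j r => wronskEntry j (D.a s) r)]
  refine Submodule.sum_mem _ fun p _ => ?_
  rw [← map_prod, ← smul_eq_C_mul]
  exact Submodule.smul_mem _ _ (wronskDet_mem_span p D.a)
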